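/- Let G be a countable amenable group with Følner sequence {F_n}, and let J_m ⊆ G be an increasing sequence of subsets with upper densities δ(J_m) → 1 as m → ∞. Let P be a polyhedron and X ⊆ P^G a subshift such that for each m the hypotheses of the lower-bound criterion hold with set J_m and constant c_m (products ∏_g W_g^m ⊆ X matching a basepoint off J_m, and c_m-expanding continuous maps f_g^m : P → W_g^m for g ∈ J_m). Then mdim(X,G) = dim(P). -/

import Mathlib

open Set Filter Topology

/-- `covDimLE X n`: every finite open cover of `X` admits a finite open refinement
of order at most `n` (i.e. each point lies in at most `n+1` members). -/
def covDimLE (X : Type) [TopologicalSpace X] (n : ℕ) : Prop :=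
  ∀ (ι : Type) (U : ι → Set X), Finite ι → (∀ i, IsOpen (U i)) → (⋃ i, U i) = Set.univ →
    ∃ (κ : Type) (V : κ → Set X), Finite κ ∧ (∀ j, IsOpen (V j)) ∧ (⋃ j, V j) = Set.univ ∧
      (∀ j, ∃ i, V j ⊆ U i) ∧ ∀ x : X, Set.ncard {j | x ∈ V j} ≤ n + 1

/-- The topological (covering) dimension of `X`, as an element of `ENNReal`
(`⊤` if no finite bound exists). -/
noncomputable def topDim (X : Type) [TopologicalSpace X] : ENNReal :=
  sInf {d : ENNReal | ∃ n : ℕ, d = n ∧ covDimLE X n}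

/-- `ε`-injectivity of `f` with respect to a distance function `ρ` on the source. -/
def IsEpsInj {X P : Type} (ρ : X → X → ℝ) (ε : ℝ) (f : X → P) : Prop :=
  ∀ x y, f x = f y → ρ x y ≤ ε

/-- The `ε`-width dimension `dim_ε(X, ρ)`: the infimum of topological dimensions of
compact metric spaces `P` admitting an `ε`-injective continuous map `X → P`. -/
noncomputable def dimEps (X : Type) [TopologicalSpace X] (ρ : X → X → ℝ) (ε : ℝ) : ENNReal :=
  sInf {d : ENNReal | ∃ (P : Type) (_ : MetricSpace P) (f : X → P),
    CompactSpace P ∧ Continuous f ∧ IsEpsInj ρ ε f ∧ topDim P = d}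


/-- A Følner sequence in a group `G`: nonempty finite sets `F n` such that for every
finite `K ⊆ G`, the proportion of the `K`-boundary `B(F_n,K)` in `F_n` tends to `0`. -/
def IsFolner {G : Type} [Group G] (F : ℕ → Finset G) : Prop :=
  (∀ n, (F n).Nonempty) ∧ ∀ K : Finset G,
    Tendsto (fun n =>
        (Set.ncard {g : G | (∃ k ∈ K, k * g ∈ F n) ∧ ∃ k ∈ K, k * g ∉ F n} : ℝ)
          / (F n).card)
      atTop (nhds 0)

/-- The upper density of `J ⊆ G`: the supremum over Følner sequences of
`limsup_n |J ∩ F_n| / |F_n|`. -/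
noncomputable def upperDensity {G : Type} [Group G] (J : Set G) : ℝ :=
  sSup {r : ℝ | ∃ F : ℕ → Finset G, IsFolner F ∧
    Filter.atTop.limsup (fun n => ((J ∩ (F n : Set G)).ncard : ℝ) / (F n).card) = r}

/-- The shift map on `P^G`: `(g' · x)_g = x_{g g'}`. -/
def shift {G P : Type} [Group G] (g' : G) (x : G → P) : G → P :=
  fun g => x (g * g')

/-- `ρ` is a metric on `Y` compatible with the given topology. -/
def IsCompatMetric {Y : Type} [TopologicalSpace Y] (ρ : Y → Y → ℝ) : Prop :=
  (∀ x y, ρ x y = 0 ↔ x = y) ∧ (∀ x y, ρ x y = ρ y x) ∧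
  (∀ x y z, ρ x z ≤ ρ x y + ρ y z) ∧
  (∀ (x : Y) (S : Set Y), S ∈ nhds x ↔ ∃ ε > 0, {y | ρ x y < ε} ⊆ S)

/-- The mean topological dimension of a subshift `X ⊆ P^G`, computed from a compatible
metric `ρ` on `P^G` and a Følner sequence `F`:
`mdim = lim_{ε→0} lim_n dim_ε(X, d_{F_n})/|F_n|` with
`d_{F_n}(x,y) = max_{g ∈ F_n} ρ(gx, gy)`. -/
noncomputable def mdimWith {G P : Type} [Group G] [TopologicalSpace P]
    (X : Set (G → P)) (ρ : (G → P) → (G → P) → ℝ)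
    (F : ℕ → Finset G) (hF : ∀ n, (F n).Nonempty) : ENNReal :=
  ⨆ (ε : ℝ) (_ : 0 < ε), Filter.atTop.limsup fun n =>
    dimEps X (fun x y => (F n).sup' (hF n) fun g => ρ (shift g x.1) (shift g y.1)) ε
      / ((F n).card : ENNReal)

/-- `X` is a (compact metric) polyhedron: it is homeomorphic to a finite union of
convex polytopes (convex hulls of finite sets) in some Euclidean space. -/
def IsPolyhedron (X : Type) [TopologicalSpace X] : Prop :=
  ∃ (N : ℕ) (S : Finset (Finset (Fin N → ℝ))),
    Nonempty (X ≃ₜ (⋃ s ∈ S, convexHull ℝ (s : Set (Fin N → ℝ)) : Set (Fin N → ℝ)))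


section Kuhn

/-- local Sperner parity -/
lemma sperner_local (k : ℕ) (a : ℕ → ℕ) (ha : ∀ j, j < k + 2 → a j ≤ k + 1) :
    (∑ j ∈ Finset.range (k+2),
      if ((Finset.range (k+2)).erase j).image a = Finset.range (k+1) then (1 : ZMod 2) else 0)
    = if (Finset.range (k+2)).image a = Finset.range (k+2) then 1 else 0 := by
  have inj_of : ∀ j ∈ Finset.range (k+2),
      ((Finset.range (k+2)).erase j).image a = Finset.range (k+1) →
      Set.InjOn a (((Finset.range (k+2)).erase j : Finset ℕ) : Set ℕ) := by
    intro j hj h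
    apply Finset.injOn_of_card_image_eq
    rw [h, Finset.card_erase_of_mem hj]; simp
  split_ifs with hfull
  · have hinj : Set.InjOn a ((Finset.range (k+2) : Finset ℕ) : Set ℕ) := by
      apply Finset.injOn_of_card_image_eq
      rw [hfull]
    have : k + 1 ∈ (Finset.range (k+2)).image a := by rw [hfull]; simp
    obtain ⟨j, hj, hjk⟩ := Finset.mem_image.1 this
    rw [Finset.sum_eq_single_of_mem j hj, if_pos]
    · have : ((Finset.range (k+2)).erase j).image a = ((Finset.range (k+2)).image a).erase (a j) := by
        ext b
        simp only [Finset.mem_image, Finset.mem_erase]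
        constructor
        · rintro ⟨i, ⟨hij, hi⟩, rfl⟩
          exact ⟨fun h => hij (hinj (by simpa using hi) (by simpa using hj) h), i, hi, rfl⟩
        · rintro ⟨h1, i, hi, rfl⟩
          exact ⟨i, ⟨fun h => h1 (by rw [h]), hi⟩, rfl⟩
      rw [this, hfull, hjk]
      ext b; simp; omega
    · intro i hi hij
      rw [if_neg]
      intro h
      have : a j ∈ ((Finset.range (k+2)).erase i).image a :=
        Finset.mem_image_of_mem _ (Finset.mem_erase.2 ⟨hij.symm, hj⟩)
      rw [h, hjk] at this
      simp at this
  · by_cases hex : ∃ j ∈ Finset.range (k+2),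
        ((Finset.range (k+2)).erase j).image a = Finset.range (k+1)
    · obtain ⟨j, hj, hjim⟩ := hex
      have hins : (Finset.range (k+2)).image a = insert (a j) (Finset.range (k+1)) := by
        rw [← hjim, ← Finset.image_insert, Finset.insert_erase hj]
      have haj : a j < k + 1 := by
        by_contra hcon
        have : a j = k + 1 := by have := ha j (by simpa using hj); omega
        apply hfull
        rw [hins, this]; ext b; simp; omega
      have : a j ∈ ((Finset.range (k+2)).erase j).image a := by rw [hjim]; simpa using haj
      obtain ⟨j', hj', hjj⟩ := Finset.mem_image.1 this
      obtain ⟨hne, hj'r⟩ := Finset.mem_erase.1 hj'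
      have hj'im : ((Finset.range (k+2)).erase j').image a = Finset.range (k+1) := by
        rw [← hjim]
        ext b
        simp only [Finset.mem_image, Finset.mem_erase]
        constructor
        · rintro ⟨i, ⟨h1, h2⟩, rfl⟩
          by_cases hij : i = j
          · exact ⟨j', ⟨hne, hj'r⟩, by rw [hjj, hij]⟩
          · exact ⟨i, ⟨hij, h2⟩, rfl⟩
        · rintro ⟨i, ⟨h1, h2⟩, rfl⟩
          by_cases hij : i = j'
          · exact ⟨j, ⟨hne.symm, hj⟩, by rw [← hjj, hij]⟩
          · exact ⟨i, ⟨hij, h2⟩, rfl⟩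
      rw [← Finset.sum_subset (s₁ := {j, j'})]
      · rw [Finset.sum_pair hne.symm, if_pos hjim, if_pos hj'im]; decide
      · intro i hi; simp only [Finset.mem_insert, Finset.mem_singleton] at hi
        rcases hi with rfl | rfl <;> assumption
      · intro i hi hi2
        simp only [Finset.mem_insert, Finset.mem_singleton, not_or] at hi2
        rw [if_neg]
        intro h
        have := (inj_of i hi h)
          (by simp only [Finset.coe_erase, Set.mem_sdiff, Finset.mem_coe]; exact ⟨hj, fun h => hi2.1 h.symm⟩)
          (by simp only [Finset.coe_erase, Set.mem_sdiff, Finset.mem_coe]; exact ⟨hj'r, fun h => hi2.2 h.symm⟩)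
          hjj.symm
        exact hne this.symm
    · push Not at hex
      apply Finset.sum_eq_zero
      intro j hj
      rw [if_neg (hex j hj)]

variable {D : ℕ}

/-- vertices of a Kuhn simplex -/
def kvert (v : Fin D → ℕ) (σ : Equiv.Perm (Fin D)) (j : ℕ) : Fin D → ℕ :=
  fun i => v i + if ((σ⁻¹ i : Fin D) : ℕ) < j then 1 else 0

def kbox (D M k : ℕ) : Finset (Fin D → ℕ) :=
  Fintype.piFinset fun i => if (i : ℕ) < k then Finset.range M else {0}

def kperm (D k : ℕ) : Finset (Equiv.Perm (Fin D)) :=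
  Finset.univ.filter fun σ => ∀ i : Fin D, k ≤ (i : ℕ) → σ i = i

lemma mem_kbox {M k : ℕ} {v : Fin D → ℕ} :
    v ∈ kbox D M k ↔ (∀ i : Fin D, (i : ℕ) < k → v i < M) ∧ ∀ i : Fin D, k ≤ (i : ℕ) → v i = 0 := by
  simp only [kbox, Fintype.mem_piFinset]
  constructor
  · intro h
    refine ⟨fun i hi => ?_, fun i hi => ?_⟩
    · have := h i; rw [if_pos hi] at this; simpa using this
    · have := h i; rw [if_neg (by omega)] at this; simpa using this
  · rintro ⟨h1, h2⟩ i
    split_ifs with hi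
    · simpa using h1 i hi
    · simpa using h2 i (by omega)

lemma mem_kperm {k : ℕ} {σ : Equiv.Perm (Fin D)} :
    σ ∈ kperm D k ↔ ∀ i : Fin D, k ≤ (i : ℕ) → σ i = i := by
  simp [kperm]

lemma kperm_inv {k : ℕ} {σ : Equiv.Perm (Fin D)} (h : σ ∈ kperm D k) (i : Fin D)
    (hi : k ≤ (i : ℕ)) : σ⁻¹ i = i := by
  rw [Equiv.Perm.inv_eq_iff_eq]; exact (mem_kperm.1 h i hi).symm

lemma kvert_le {M k j : ℕ} {v : Fin D → ℕ} {σ : Equiv.Perm (Fin D)} (hv : v ∈ kbox D M k)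
    (hM : 0 < M) (i : Fin D) : kvert v σ j i ≤ M := by
  unfold kvert
  by_cases hi : (i : ℕ) < k
  · have := (mem_kbox.1 hv).1 i hi
    split_ifs <;> omega
  · have := (mem_kbox.1 hv).2 i (by omega)
    split_ifs <;> omega

lemma kvert_zero {M k j : ℕ} {v : Fin D → ℕ} {σ : Equiv.Perm (Fin D)} (hv : v ∈ kbox D M k)
    (hσ : σ ∈ kperm D k) (hj : j ≤ k) (i : Fin D) (hi : k ≤ (i : ℕ)) : kvert v σ j i = 0 := by
  unfold kvert
  rw [kperm_inv hσ i hi, (mem_kbox.1 hv).2 i hi, if_neg (by omega)]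

/-- fullness indicator -/
def kfull (ℓ : (Fin D → ℕ) → ℕ) (k : ℕ) (v : Fin D → ℕ) (σ : Equiv.Perm (Fin D)) : ZMod 2 :=
  if (Finset.range (k+1)).image (fun j => ℓ (kvert v σ j)) = Finset.range (k+1) then 1 else 0

def kfacet (ℓ : (Fin D → ℕ) → ℕ) (k : ℕ) (v : Fin D → ℕ) (σ : Equiv.Perm (Fin D)) (j : ℕ) :
    ZMod 2 :=
  if ((Finset.range (k+2)).erase j).image (fun j => ℓ (kvert v σ j)) = Finset.range (k+1)
    then 1 else 0

lemma kfacet_last (ℓ : (Fin D → ℕ) → ℕ) (k : ℕ) (v : Fin D → ℕ) (σ : Equiv.Perm (Fin D)) :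
    kfacet ℓ k v σ (k+1) = kfull ℓ k v σ := by
  unfold kfacet kfull
  have : (Finset.range (k+2)).erase (k+1) = Finset.range (k+1) := by
    ext b; simp; omega
  rw [this]

lemma kfacet_zero (ℓ : (Fin D → ℕ) → ℕ) (k : ℕ) (hk : k < D) (v : Fin D → ℕ)
    (σ : Equiv.Perm (Fin D)) :
    kfacet ℓ k v σ 0 = kfull ℓ k
      (v + Pi.single ((σ * Fin.cycleRange ⟨k, hk⟩) ⟨k, hk⟩) 1) (σ * Fin.cycleRange ⟨k, hk⟩) := by
  unfold kfacet kfull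
  have : (Finset.range (k+2)).erase 0 = (Finset.range (k+1)).image (fun j => j + 1) := by
    ext b
    simp only [Finset.mem_erase, Finset.mem_range, Finset.mem_image]
    constructor
    · rintro ⟨h1, h2⟩; exact ⟨b - 1, by omega, by omega⟩
    · rintro ⟨c, h1, h2⟩; omega
  rw [this, Finset.image_image]
  have : ∀ j ∈ Finset.range (k+1), ((fun j => ℓ (kvert v σ j)) ∘ fun j => j + 1) j =
      ℓ (kvert (v + Pi.single ((σ * Fin.cycleRange ⟨k, hk⟩) ⟨k, hk⟩) 1)
        (σ * Fin.cycleRange ⟨k, hk⟩) j) := by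
    intro j hj
    simp only [Finset.mem_range] at hj
    simp only [Function.comp]
    congr 1
    ext i
    obtain ⟨u, rfl⟩ := σ.surjective i
    obtain ⟨w, rfl⟩ := (Fin.cycleRange (⟨k, hk⟩ : Fin D)).surjective u
    have hinv : ∀ (τ : Equiv.Perm (Fin D)) x, τ⁻¹ (τ x) = x := fun τ x => by simp
    simp only [kvert, mul_inv_rev, Equiv.Perm.mul_apply, hinv, Pi.add_apply]
    have key : (Pi.single (σ (Fin.cycleRange (⟨k, hk⟩ : Fin D) ⟨k, hk⟩)) 1 : Fin D → ℕ)
        (σ (Fin.cycleRange (⟨k, hk⟩ : Fin D) w)) = if w = ⟨k, hk⟩ then 1 else 0 := by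
      rw [Pi.single_apply]; simp
    rw [key]
    have : NeZero D := ⟨by omega⟩
    rcases lt_trichotomy w ⟨k, hk⟩ with h | h | h
    · rw [Fin.cycleRange_of_lt h, if_neg h.ne]
      have hv : ((w + 1 : Fin D) : ℕ) = w + 1 := by
        rw [Fin.val_add_one_of_lt']
        have : (w : ℕ) < k := h
        omega
      rw [hv]
      simp
    · subst h
      rw [Fin.cycleRange_self]
      have h0 : ((0 : Fin D) : ℕ) = 0 := rfl
      simp
      omega
    · rw [Fin.cycleRange_of_gt h, if_neg h.ne']
      have : k < (w : ℕ) := h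
      rw [if_neg (by omega), if_neg (by omega)]
  rw [Finset.image_congr (g := fun j => ℓ (kvert (v + Pi.single ((σ * Fin.cycleRange ⟨k, hk⟩) ⟨k, hk⟩) 1)
        (σ * Fin.cycleRange ⟨k, hk⟩) j)) (fun j hj => this j hj)]

lemma kfacet_mid (ℓ : (Fin D → ℕ) → ℕ) (k : ℕ) (v : Fin D → ℕ)
    (σ : Equiv.Perm (Fin D)) (j : ℕ) (hj : j + 1 < D) :
    kfacet ℓ k v (σ * Equiv.swap ⟨j, by omega⟩ ⟨j+1, hj⟩) (j+1) = kfacet ℓ k v σ (j+1) := by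
  unfold kfacet
  rw [Finset.image_congr (g := fun j => ℓ (kvert v σ j))]
  intro t ht
  simp only [Finset.coe_erase, Set.mem_sdiff, Finset.mem_coe, Set.mem_singleton_iff] at ht
  have ht2 := ht.2
  simp only
  congr 1
  ext i
  simp only [kvert, mul_inv_rev, Equiv.Perm.mul_apply, Equiv.swap_inv]
  generalize σ⁻¹ i = u
  congr 2
  rw [Equiv.swap_apply_def]
  split_ifs with h1 h2
  · subst h1; simp; omega
  · subst h2; simp; omega
  · rfl

lemma ksum_mid (ℓ : (Fin D → ℕ) → ℕ) (k : ℕ) (hk : k < D) (v : Fin D → ℕ) (j : ℕ) (hj : j < k) :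
    ∑ σ ∈ kperm D (k+1), kfacet ℓ k v σ (j+1) = 0 := by
  apply Finset.sum_involution
    (fun σ _ => σ * Equiv.swap (⟨j, by omega⟩ : Fin D) ⟨j+1, by omega⟩)
  · intro σ hσ
    rw [kfacet_mid]
    exact CharTwo.add_self_eq_zero _
  · intro σ hσ _ h
    have : Equiv.swap (⟨j, by omega⟩ : Fin D) ⟨j+1, by omega⟩ = 1 := by
      simp at h
    rw [Equiv.swap_eq_one_iff] at this
    simp at this
  case g_mem =>
    intro σ hσ
    rw [mem_kperm] at hσ ⊢
    intro i hi
    rw [Equiv.Perm.mul_apply, Equiv.swap_apply_of_ne_of_ne, hσ i hi]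
    · intro h; rw [h] at hi; simp at hi; omega
    · intro h; rw [h] at hi; simp at hi; omega
  case hg₄ =>
    intro σ hσ
    rw [mul_assoc, Equiv.swap_mul_self, mul_one]

lemma kperm_apply_lt {k : ℕ} (hk : k < D) {σ : Equiv.Perm (Fin D)} (h : σ ∈ kperm D (k+1)) :
    ((σ ⟨k, hk⟩ : Fin D) : ℕ) ≤ k := by
  by_contra hcon
  have h1 := mem_kperm.1 h (σ ⟨k, hk⟩) (by omega)
  have h2 := σ.injective h1
  rw [h2] at hcon
  simp at hcon

lemma ksum_zero (ℓ : (Fin D → ℕ) → ℕ) (k : ℕ) (hk : k < D) (B : Finset (Fin D → ℕ)) :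
    ∑ σ ∈ kperm D (k+1), ∑ v ∈ B, kfacet ℓ k v σ 0 =
    ∑ σ ∈ kperm D (k+1), ∑ v ∈ B, kfull ℓ k (v + Pi.single (σ ⟨k, hk⟩) 1) σ := by
  have hrot : ∀ i : Fin D, k + 1 ≤ (i : ℕ) → Fin.cycleRange (⟨k, hk⟩ : Fin D) i = i := by
    intro i hi
    apply Fin.cycleRange_of_gt
    exact hi
  apply Finset.sum_bij' (fun σ _ => σ * Fin.cycleRange ⟨k, hk⟩)
    (fun σ _ => σ * (Fin.cycleRange ⟨k, hk⟩)⁻¹)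
  · intro σ hσ
    rw [mem_kperm] at hσ ⊢
    intro i hi
    rw [Equiv.Perm.mul_apply, hrot i hi, hσ i hi]
  · intro σ hσ
    rw [mem_kperm] at hσ ⊢
    intro i hi
    rw [Equiv.Perm.mul_apply, Equiv.Perm.inv_eq_iff_eq.2 (hrot i hi).symm, hσ i hi]
  · intro σ hσ; simp
  · intro σ hσ; simp
  · intro σ hσ
    apply Finset.sum_congr rfl
    intro v hv
    exact kfacet_zero ℓ k hk v σ

structure KLabel (D M : ℕ) (ℓ : (Fin D → ℕ) → ℕ) : Prop where
  pos : 0 < M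
  le : ∀ v, (∀ i, v i ≤ M) → ∀ k ≤ D, (∀ i : Fin D, k ≤ (i : ℕ) → v i = 0) → ℓ v ≤ k
  zero : ∀ v, (∀ i, v i ≤ M) → ∀ i : Fin D, v i = 0 → ℓ v ≤ i
  top : ∀ v, (∀ i, v i ≤ M) → ∀ i : Fin D, v i = M → ℓ v ≠ i

lemma ktele {M : ℕ} {ℓ : (Fin D → ℕ) → ℕ} (H : KLabel D M ℓ) (k : ℕ) (hk : k < D)
    (σ : Equiv.Perm (Fin D)) (hσ : σ ∈ kperm D (k+1)) :
    (∑ v ∈ kbox D M (k+1), kfull ℓ k (v + Pi.single (σ ⟨k, hk⟩) 1) σ) +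
      ∑ v ∈ kbox D M (k+1), kfull ℓ k v σ =
    ∑ v ∈ (kbox D M (k+1)).filter (fun v => v (σ ⟨k, hk⟩) = 0), kfull ℓ k v σ := by
  have hak := kperm_apply_lt hk hσ
  have hinv : σ⁻¹ (σ ⟨k, hk⟩) = ⟨k, hk⟩ := by simp
  set a := σ ⟨k, hk⟩ with ha
  have hM := H.pos
  rw [← Finset.sum_filter_add_sum_filter_not (kbox D M (k+1)) (fun v => v a = 0)
    (fun v => kfull ℓ k v σ)]
  have hs := Finset.sum_filter_add_sum_filter_not (kbox D M (k+1)) (fun v => v a = M - 1)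
    (fun v => kfull ℓ k (v + Pi.single a 1) σ)
  have h1 : ∑ v ∈ (kbox D M (k+1)).filter (fun v => v a = M - 1),
      kfull ℓ k (v + Pi.single a 1) σ = 0 := by
    apply Finset.sum_eq_zero
    intro v hv
    obtain ⟨hv, hva⟩ := Finset.mem_filter.1 hv
    unfold kfull
    rw [if_neg]
    intro h
    have : (a : ℕ) ∈ Finset.range (k+1) := by simp; omega
    rw [← h] at this
    obtain ⟨j, hj, hja⟩ := Finset.mem_image.1 this
    simp only [Finset.mem_range] at hj
    refine H.top _ ?_ a ?_ hja
    · intro i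
      unfold kvert
      by_cases hia : i = a
      · subst hia
        rw [hinv, if_neg (by simp; omega)]
        simp [hva]; omega
      · have := kvert_le (σ := σ) (j := j) hv hM i
        unfold kvert at this
        simpa [hia] using this
    · unfold kvert
      rw [hinv, if_neg (by simp; omega)]
      simp [hva]; omega
  have h2 : ∑ v ∈ (kbox D M (k+1)).filter (fun v => ¬ v a = M - 1),
      kfull ℓ k (v + Pi.single a 1) σ =
      ∑ v ∈ (kbox D M (k+1)).filter (fun v => ¬ v a = 0), kfull ℓ k v σ := by
    refine Finset.sum_bij' (fun v _ => v + Pi.single a 1) (fun v _ => v - Pi.single a 1) ?_ ?_ ?_ ?_ ?_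
    · intro v hv
      obtain ⟨hv, hva⟩ := Finset.mem_filter.1 hv
      rw [mem_kbox] at hv
      rw [Finset.mem_filter, mem_kbox]
      refine ⟨⟨fun i hi => ?_, fun i hi => ?_⟩, by simp⟩
      · by_cases hia : i = a
        · subst hia; have := hv.1 _ hi; simp; omega
        · simpa [hia] using hv.1 i hi
      · have hia : i ≠ a := by rintro rfl; omega
        simpa [hia] using hv.2 i hi
    · intro v hv
      obtain ⟨hv, hva⟩ := Finset.mem_filter.1 hv
      rw [mem_kbox] at hv
      rw [Finset.mem_filter, mem_kbox]
      refine ⟨⟨fun i hi => ?_, fun i hi => ?_⟩, ?_⟩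
      · by_cases hia : i = a
        · subst hia; have := hv.1 _ hi; simp; omega
        · simpa [hia] using hv.1 i hi
      · have hia : i ≠ a := by rintro rfl; omega
        simpa [hia] using hv.2 i hi
      · have := hv.1 a (by omega)
        simp; omega
    · intro v hv; simp
    · intro v hv
      obtain ⟨hv, hva⟩ := Finset.mem_filter.1 hv
      ext i
      by_cases hia : i = a
      · subst hia; simp; omega
      · simp [hia]
    · intro v hv; rfl
  rw [h1, h2, zero_add] at hs
  refine (congrArg₂ (· + ·) hs.symm rfl).trans ?_
  rw [add_comm, add_assoc, CharTwo.add_self_eq_zero, add_zero]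

lemma kstep {M : ℕ} {ℓ : (Fin D → ℕ) → ℕ} (H : KLabel D M ℓ) (k : ℕ) (hk : k < D) :
    ∑ σ ∈ kperm D (k+1), ∑ v ∈ kbox D M (k+1), kfull ℓ (k+1) v σ =
    ∑ σ ∈ kperm D k, ∑ v ∈ kbox D M k, kfull ℓ k v σ := by
  have hM := H.pos
  have e1 : ∀ σ ∈ kperm D (k+1), ∀ v ∈ kbox D M (k+1), kfull ℓ (k+1) v σ =
      ∑ j ∈ Finset.range (k+2), kfacet ℓ k v σ j := by
    intro σ hσ v hv
    unfold kfull kfacet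
    rw [sperner_local k (fun j => ℓ (kvert v σ j))]
    intro j hj
    exact H.le _ (kvert_le hv hM) _ (by omega) (fun i hi => kvert_zero hv hσ (by omega) i hi)
  rw [Finset.sum_congr rfl (fun σ hσ => Finset.sum_congr rfl (fun v hv => e1 σ hσ v hv))]
  have e2 : ∀ σ ∈ kperm D (k+1), ∑ v ∈ kbox D M (k+1), ∑ j ∈ Finset.range (k+2), kfacet ℓ k v σ j
      = (∑ v ∈ kbox D M (k+1), ∑ j ∈ Finset.range k, kfacet ℓ k v σ (j+1)) +
        (∑ v ∈ kbox D M (k+1), kfacet ℓ k v σ 0) + ∑ v ∈ kbox D M (k+1), kfull ℓ k v σ := by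
    intro σ hσ
    rw [← Finset.sum_add_distrib, ← Finset.sum_add_distrib]
    apply Finset.sum_congr rfl
    intro v hv
    rw [Finset.sum_range_succ, Finset.sum_range_succ', kfacet_last]
  rw [Finset.sum_congr rfl e2, Finset.sum_add_distrib, Finset.sum_add_distrib]
  have e3 : ∑ σ ∈ kperm D (k+1), ∑ v ∈ kbox D M (k+1), ∑ j ∈ Finset.range k,
      kfacet ℓ k v σ (j+1) = 0 := by
    rw [Finset.sum_comm]
    apply Finset.sum_eq_zero
    intro v hv
    rw [Finset.sum_comm]
    apply Finset.sum_eq_zero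
    intro j hj
    exact ksum_mid ℓ k hk v j (by simpa using hj)
  rw [e3, zero_add, ksum_zero ℓ k hk, ← Finset.sum_add_distrib,
    Finset.sum_congr rfl (fun σ hσ => ktele H k hk σ hσ)]
  have hsub : kperm D k ⊆ kperm D (k+1) := by
    intro σ hσ
    rw [mem_kperm] at hσ ⊢
    intro i hi; exact hσ i (by omega)
  rw [← Finset.sum_subset hsub]
  · apply Finset.sum_congr rfl
    intro σ hσ
    rw [mem_kperm] at hσ
    rw [hσ ⟨k, hk⟩ (le_refl k)]
    apply Finset.sum_congr _ (fun _ _ => rfl)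
    ext v
    rw [Finset.mem_filter, mem_kbox, mem_kbox]
    constructor
    · rintro ⟨⟨h1, h2⟩, h3⟩
      refine ⟨fun i hi => h1 i (by omega), fun i hi => ?_⟩
      rcases hi.eq_or_lt with h | h
      · have : i = ⟨k, hk⟩ := Fin.ext h.symm
        rw [this, h3]
      · exact h2 i h
    · rintro ⟨h1, h2⟩
      refine ⟨⟨fun i hi => ?_, fun i hi => h2 i (by omega)⟩, h2 _ (le_refl k)⟩
      by_cases h : (i : ℕ) < k
      · exact h1 i h
      · rw [h2 i (by omega)]; exact hM
  · intro σ hσ hσ'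
    have hak := kperm_apply_lt hk hσ
    have hne : ((σ ⟨k, hk⟩ : Fin D) : ℕ) ≠ k := by
      intro h
      apply hσ'
      rw [mem_kperm] at hσ ⊢
      intro i hi
      rcases hi.eq_or_lt with h' | h'
      · have : i = ⟨k, hk⟩ := Fin.ext h'.symm
        rw [this]; exact Fin.ext h
      · exact hσ i h'
    apply Finset.sum_eq_zero
    intro v hv
    obtain ⟨hv, hva⟩ := Finset.mem_filter.1 hv
    unfold kfull
    rw [if_neg]
    intro h
    have : k ∈ Finset.range (k+1) := by simp
    rw [← h] at this
    obtain ⟨j, hj, hja⟩ := Finset.mem_image.1 this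
    simp only [Finset.mem_range] at hj
    have := H.zero (kvert v σ j) (kvert_le hv hM) (σ ⟨k, hk⟩) (by
      unfold kvert
      have hinv : σ⁻¹ (σ ⟨k, hk⟩) = ⟨k, hk⟩ := by simp
      rw [hinv, if_neg (by simp; omega), hva])
    omega

lemma kuhn {M : ℕ} {ℓ : (Fin D → ℕ) → ℕ} (H : KLabel D M ℓ) :
    ∃ v σ, (∀ j i, kvert v σ j i ≤ M) ∧
      (Finset.range (D+1)).image (fun j => ℓ (kvert v σ j)) = Finset.range (D+1) := by
  have hall : ∀ k ≤ D, ∑ σ ∈ kperm D k, ∑ v ∈ kbox D M k, kfull ℓ k v σ = 1 := by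
    intro k
    induction k with
    | zero =>
      intro _
      have h1 : kperm D 0 = {1} := by
        ext σ; rw [mem_kperm]; simp [Equiv.ext_iff]
      have h2 : kbox D M 0 = {0} := by
        ext v; rw [mem_kbox]; simp [funext_iff]
      rw [h1, h2, Finset.sum_singleton, Finset.sum_singleton]
      unfold kfull
      rw [if_pos]
      have : ℓ (kvert 0 1 0) = 0 := by
        have := H.le (kvert 0 1 0) (by simp [kvert]) 0 (by omega) (by simp [kvert])
        omega
      simp [this]
    | succ k ih =>
      intro hk
      rw [kstep H k (by omega)]
      exact ih (by omega)
  have hD := hall D le_rfl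
  obtain ⟨σ, hσ, h1⟩ := Finset.exists_ne_zero_of_sum_ne_zero (by rw [hD]; exact one_ne_zero)
  obtain ⟨v, hv, h2⟩ := Finset.exists_ne_zero_of_sum_ne_zero h1
  refine ⟨v, σ, fun j i => kvert_le hv H.pos i, ?_⟩
  unfold kfull at h2
  by_contra hcon
  exact h2 (if_neg hcon)

end Kuhn


lemma lebesgue_cover (D : ℕ) (κ : Type) [Finite κ] (V : κ → Set (Fin D → unitInterval))
    (hVo : ∀ j, IsOpen (V j)) (hVc : (⋃ j, V j) = Set.univ)
    (hopp : ∀ j i, ∀ x ∈ V j, ∀ y ∈ V j, ¬ (x i = 0 ∧ y i = 1)) :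
    ∃ x, D + 1 ≤ Set.ncard {j | x ∈ V j} := by
  classical
  obtain ⟨W, hWc, hWcl, hWV⟩ := exists_iUnion_eq_closed_subset hVo (fun x => Set.toFinite _) hVc
  -- Lebesgue number
  let O : (Fin D → unitInterval) → Set (Fin D → unitInterval) :=
    fun x => ⋂ j ∈ {j | x ∉ W j}, (W j)ᶜ
  have hO : ∀ x, IsOpen (O x) := by
    intro x
    apply Set.Finite.isOpen_biInter (Set.toFinite _)
    intro j _
    exact (hWcl j).isOpen_compl
  have hOx : ∀ x, x ∈ O x := by
    intro x
    simp only [O, Set.mem_iInter]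
    intro j hj; exact hj
  obtain ⟨δ, hδ, hleb⟩ := lebesgue_number_lemma_of_metric (isCompact_univ) hO
    (fun x _ => Set.mem_iUnion.2 ⟨x, hOx x⟩)
  obtain ⟨M', hM'⟩ := exists_nat_one_div_lt hδ
  set M := M' + 1 with hMdef
  have hM : 0 < M := by omega
  have hMr : (0 : ℝ) < M := by exact_mod_cast hM
  let pt : (Fin D → ℕ) → (Fin D → unitInterval) :=
    fun v i => Set.projIcc (0:ℝ) 1 zero_le_one ((v i : ℝ) / M)
  have hptv : ∀ v : Fin D → ℕ, (∀ i, v i ≤ M) → ∀ i, ((pt v i : unitInterval) : ℝ) = (v i : ℝ) / M := by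
    intro v hv i
    simp only [pt]
    rw [Set.projIcc_of_mem]
    refine ⟨by positivity, ?_⟩
    rw [div_le_one hMr]; exact_mod_cast hv i
  have hcol : ∀ x, ∃ j, x ∈ W j := by
    intro x
    have : x ∈ ⋃ j, W j := by rw [hWc]; trivial
    simpa using this
  choose col hcol using hcol
  let lab : κ → ℕ := fun j => sInf {i : ℕ | i = D ∨ ∃ h : i < D, ∃ x ∈ V j, x ⟨i, h⟩ = 0}
  have hlabD : ∀ j, lab j ≤ D := fun j => Nat.sInf_le (Or.inl rfl)
  have hlabmem : ∀ j, lab j = D ∨ ∃ h : lab j < D, ∃ x ∈ V j, x ⟨lab j, h⟩ = 0 := by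
    intro j
    exact Nat.sInf_mem (s := {i : ℕ | i = D ∨ ∃ h : i < D, ∃ x ∈ V j, x ⟨i, h⟩ = 0})
      ⟨D, Or.inl rfl⟩
  have hzero : ∀ v, (∀ i, v i ≤ M) → ∀ i : Fin D, v i = 0 → lab (col (pt v)) ≤ i := by
    intro v hv i hi
    apply Nat.sInf_le
    right
    refine ⟨i.2, pt v, hWV _ (hcol _), ?_⟩
    apply Subtype.ext
    rw [hptv v hv, hi]; simp
  have H : KLabel D M (fun v => lab (col (pt v))) := by
    refine ⟨hM, ?_, hzero, ?_⟩
    · intro v hv k hk h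
      rcases hk.eq_or_lt with rfl | hk
      · exact hlabD _
      · exact hzero v hv ⟨k, hk⟩ (h _ le_rfl)
    · intro v hv i hi hl
      rcases hlabmem (col (pt v)) with h | ⟨h, x, hx, hx0⟩
      · have := i.2; omega
      · refine hopp _ i x hx (pt v) (hWV _ (hcol _)) ⟨?_, ?_⟩
        · rw [← hx0]; congr 1; exact Fin.ext hl.symm
        · apply Subtype.ext
          rw [hptv v hv, hi]; simp
  obtain ⟨v, σ, hle, him⟩ := kuhn H
  obtain ⟨x, hx⟩ := hleb (pt (kvert v σ 0)) trivial
  refine ⟨x, ?_⟩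
  have hclose : ∀ j, pt (kvert v σ j) ∈ O x := by
    intro j
    apply hx
    rw [Metric.mem_ball]
    refine lt_of_le_of_lt ?_ hM'
    rw [dist_pi_le_iff (by positivity)]
    intro i
    rw [Subtype.dist_eq, hptv _ (hle j), hptv _ (hle 0), Real.dist_eq, ← sub_div, abs_div,
      abs_of_pos hMr]
    have : ((M' : ℝ) + 1) = M := by rw [hMdef]; push_cast; rfl
    rw [this]
    apply div_le_div_of_nonneg_right _ hMr.le
    simp only [kvert]
    push_cast
    rw [abs_le]
    split_ifs <;> constructor <;> linarith
  have hmem : ∀ j, x ∈ V (col (pt (kvert v σ j))) := by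
    intro j
    apply hWV
    by_contra hcon
    have := hclose j
    simp only [O, Set.mem_iInter] at this
    exact this _ hcon (hcol _)
  have hsub : (↑(Finset.range (D+1)) : Set ℕ) ⊆ lab '' {j | x ∈ V j} := by
    intro l hl
    rw [← him] at hl
    simp only [Finset.coe_image, Set.mem_image] at hl
    obtain ⟨j, hj, rfl⟩ := hl
    exact ⟨_, hmem j, rfl⟩
  calc D + 1 = Set.ncard (↑(Finset.range (D+1)) : Set ℕ) := by
        rw [Set.ncard_coe_finset]; simp
    _ ≤ Set.ncard (lab '' {j | x ∈ V j}) := Set.ncard_le_ncard hsub (Set.toFinite _)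
    _ ≤ _ := Set.ncard_image_le (Set.toFinite _)

lemma dim_lower_fin (D : ℕ) (Q : Type) [MetricSpace Q] [CompactSpace Q]
    (f : (Fin D → unitInterval) → Q) (hf : Continuous f)
    (hinj : ∀ x y, f x = f y → ∀ i, ¬ (x i = 0 ∧ y i = 1)) (k : ℕ) (hk : covDimLE Q k) :
    D ≤ k := by
  classical
  let c : Bool → unitInterval := fun b => if b then 1 else 0
  let B : Fin D → Bool → Set Q := fun i b => f '' {x | x i = c b}
  have hBcl : ∀ i b, IsClosed (B i b) := by
    intro i b
    apply IsCompact.isClosed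
    apply IsCompact.image _ hf
    apply IsClosed.isCompact
    exact isClosed_eq (continuous_apply i) continuous_const
  let U : (Fin D → Bool) → Set Q := fun s => ⋂ i, (B i (s i))ᶜ
  have hUo : ∀ s, IsOpen (U s) := fun s => isOpen_iInter_of_finite fun i => (hBcl i _).isOpen_compl
  have hUc : (⋃ s, U s) = Set.univ := by
    rw [Set.eq_univ_iff_forall]
    intro q
    have : ∀ i, ∃ b, q ∉ B i b := by
      intro i
      by_contra hcon
      push Not at hcon
      obtain ⟨x, hx, hxq⟩ := hcon false
      obtain ⟨y, hy, hyq⟩ := hcon true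
      exact hinj x y (hxq.trans hyq.symm) i ⟨by simpa [c] using hx, by simpa [c] using hy⟩
    choose s hs using this
    exact Set.mem_iUnion.2 ⟨s, Set.mem_iInter.2 hs⟩
  obtain ⟨κ, V, hκ, hVo, hVc, hVU, hord⟩ := hk _ U inferInstance hUo hUc
  obtain ⟨x, hx⟩ := lebesgue_cover D κ (fun j => f ⁻¹' V j) (fun j => (hVo j).preimage hf)
    (by rw [← Set.preimage_iUnion, hVc, Set.preimage_univ]) (by
      rintro j i x hx y hy ⟨hx0, hy1⟩
      obtain ⟨s, hs⟩ := hVU j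
      have h1 := Set.mem_iInter.1 (hs hx) i
      have h2 := Set.mem_iInter.1 (hs hy) i
      cases hsi : s i with
      | false =>
        rw [hsi] at h1
        exact h1 ⟨x, by simpa [c] using hx0, rfl⟩
      | true =>
        rw [hsi] at h2
        exact h2 ⟨y, by simpa [c] using hy1, rfl⟩)
  have := hord (f x)
  have h2 : D + 1 ≤ k + 1 := hx.trans this
  omega

lemma dim_lower (T : Type) [Fintype T] (Q : Type) [MetricSpace Q] [CompactSpace Q]
    (f : (T → unitInterval) → Q) (hf : Continuous f)
    (hinj : ∀ x y, f x = f y → ∀ i, ¬ (x i = 0 ∧ y i = 1)) :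
    (Fintype.card T : ENNReal) ≤ topDim Q := by
  apply le_sInf
  rintro d ⟨k, rfl, hk⟩
  let e := Fintype.equivFin T
  have := dim_lower_fin (Fintype.card T) Q (fun x => f (fun t => x (e t)))
    (hf.comp (by fun_prop)) (by
      intro x y h i hxy
      refine hinj _ _ h (e.symm i) ?_
      simpa using hxy) k hk
  exact_mod_cast this

/-- small-sign-classes property -/
def SignProp (X : Type) [MetricSpace X] (d : ℕ) : Prop :=
  ∀ ε > 0, ∃ (T : Type) (_ : Fintype T) (h : T → X → ℝ), (∀ t, Continuous (h t)) ∧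
    (∀ x, Set.ncard {t | h t x = 0} ≤ d) ∧
    ∀ x y, (∀ t, SignType.sign (h t x) = SignType.sign (h t y)) → dist x y < ε

lemma covDimLE_of_signProp (X : Type) [MetricSpace X] [CompactSpace X] (d : ℕ)
    (H : SignProp X d) : covDimLE X d := by
  classical
  intro ι U _ hUo hUc
  obtain ⟨δ, hδ, hleb⟩ := lebesgue_number_lemma_of_metric (isCompact_univ) hUo hUc.ge
  obtain ⟨T, _, h, hcont, hz, hcls⟩ := H δ hδ
  let κ := {s : T → SignType // ∃ x, ∀ t, SignType.sign (h t x) = s t}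
  have hκ : ∀ s : κ, ∃ i, ∀ y, (∀ t, SignType.sign (h t y) = s.1 t) → y ∈ U i := by
    rintro ⟨s, x, hx⟩
    obtain ⟨i, hi⟩ := hleb x trivial
    refine ⟨i, fun y hy => hi ?_⟩
    rw [Metric.mem_ball]
    exact hcls y x (fun t => by rw [hy, hx])
  choose ix hix using hκ
  let A : κ → Set X := fun s => {x | (∀ t t', s.1 t = 0 → s.1 t' ≠ 0 → |h t x| < |h t' x|) ∧
    ∀ t, s.1 t ≠ 0 → SignType.sign (h t x) = s.1 t}
  have hAo : ∀ s, IsOpen (A s) := by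
    intro s
    have e : A s = (⋂ t, ⋂ t', {x | s.1 t = 0 → s.1 t' ≠ 0 → |h t x| < |h t' x|}) ∩
        ⋂ t, {x | s.1 t ≠ 0 → SignType.sign (h t x) = s.1 t} := by
      ext x; simp [A]
    rw [e]
    apply IsOpen.inter
    · refine isOpen_iInter_of_finite fun t => isOpen_iInter_of_finite fun t' => ?_
      by_cases h1 : s.1 t = 0
      · by_cases h2 : s.1 t' ≠ 0
        · simp only [h1, h2, ne_eq, not_false_eq_true, forall_const]
          exact isOpen_lt (hcont t).abs (hcont t').abs
        · simp [h2]
      · simp [h1]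
    · refine isOpen_iInter_of_finite fun t => ?_
      rcases hst : s.1 t with _ | _ | _
      · simp
      · have : {x | SignType.neg ≠ 0 → SignType.sign (h t x) = SignType.neg} = {x | h t x < 0} := by
          ext x
          simp only [Set.mem_ofPred_eq]
          constructor
          · intro hh; exact sign_eq_neg_one_iff.1 (hh (by decide))
          · intro hh _; exact sign_eq_neg_one_iff.2 hh
        rw [this]
        exact isOpen_lt (hcont t) continuous_const
      · have : {x | SignType.pos ≠ 0 → SignType.sign (h t x) = SignType.pos} = {x | 0 < h t x} := by
          ext x
          simp only [Set.mem_ofPred_eq]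
          constructor
          · intro hh; exact sign_eq_one_iff.1 (hh (by decide))
          · intro hh _; exact sign_eq_one_iff.2 hh
        rw [this]
        exact isOpen_lt continuous_const (hcont t)
  refine ⟨κ, fun s => A s ∩ U (ix s), inferInstance, fun s => (hAo s).inter (hUo _), ?_,
    fun s => ⟨ix s, Set.inter_subset_right⟩, ?_⟩
  · rw [Set.eq_univ_iff_forall]
    intro x
    refine Set.mem_iUnion.2 ⟨⟨fun t => SignType.sign (h t x), x, fun t => rfl⟩, ⟨?_, ?_⟩, ?_⟩
    · intro t t' h1 h2
      simp only [sign_eq_zero_iff, ne_eq] at h1 h2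
      rw [h1, abs_zero]; exact abs_pos.2 h2
    · intro t _; rfl
    · apply hix; intro t; rfl
  · intro x
    let Z : κ → Finset T := fun s => Finset.univ.filter fun t => s.1 t = 0
    have hZ : ∀ s, (Z s).card ≤ d := by
      rintro ⟨s, y, hy⟩
      refine le_trans (le_of_eq ?_) (hz y)
      rw [← Set.ncard_coe_finset]
      congr 1
      ext t
      simp [Z, ← hy]
    have hinj : Set.InjOn (fun s => (Z s).card) {j | x ∈ A j ∩ U (ix j)} := by
      rintro s ⟨⟨hs1, hs2⟩, -⟩ s' ⟨⟨hs1', hs2'⟩, -⟩ hcard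
      simp only at hcard
      have hZeq : Z s = Z s' := by
        by_contra hne
        have n1 : ¬ Z s ⊆ Z s' := fun hh => hne (Finset.eq_of_subset_of_card_le hh hcard.ge)
        have n2 : ¬ Z s' ⊆ Z s := fun hh => hne (Finset.eq_of_subset_of_card_le hh hcard.le).symm
        obtain ⟨t, ht, ht'⟩ := Finset.not_subset.1 n1
        obtain ⟨u, hu, hu'⟩ := Finset.not_subset.1 n2
        simp only [Z, Finset.mem_filter, Finset.mem_univ, true_and] at ht ht' hu hu'
        exact lt_asymm (hs1 t u ht hu') (hs1' u t hu ht')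
      apply Subtype.ext
      funext t
      have : t ∈ Z s ↔ t ∈ Z s' := by rw [hZeq]
      simp only [Z, Finset.mem_filter, Finset.mem_univ, true_and] at this
      by_cases h0 : s.1 t = 0
      · rw [h0, this.1 h0]
      · rw [← hs2 t h0, ← hs2' t (fun hh => h0 (this.2 hh))]
    calc _ = Set.ncard ((fun s => (Z s).card) '' {j | x ∈ A j ∩ U (ix j)}) :=
          (Set.InjOn.ncard_image hinj).symm
      _ ≤ Set.ncard (↑(Finset.range (d+1)) : Set ℕ) := by
          apply Set.ncard_le_ncard _ (Set.toFinite _)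
          rintro _ ⟨s, -, rfl⟩
          have := hZ s
          simp; omega
      _ = d + 1 := by rw [Set.ncard_coe_finset]; simp

lemma topDim_le_of_signProp (X : Type) [MetricSpace X] [CompactSpace X] (d : ℕ)
    (H : SignProp X d) : topDim X ≤ d :=
  sInf_le ⟨d, rfl, covDimLE_of_signProp X d H⟩

lemma signProp_pi (X : Type) [MetricSpace X] (d : ℕ) (H : SignProp X d) (A : Type) [Fintype A] :
    SignProp (A → X) (Fintype.card A * d) := by
  classical
  intro ε hε
  obtain ⟨T, _, h, hcont, hz, hcls⟩ := H ε hε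
  refine ⟨A × T, inferInstance, fun p x => h p.2 (x p.1), ?_, ?_, ?_⟩
  · rintro ⟨a, t⟩
    exact (hcont t).comp (continuous_apply a)
  · intro x
    have : {p : A × T | h p.2 (x p.1) = 0} =
        ↑((Finset.univ : Finset A).sigma (fun a => Finset.univ.filter fun t => h t (x a) = 0) |>.map
          (Equiv.sigmaEquivProd A T).toEmbedding) := by
      ext ⟨a, t⟩
      simp
    rw [this, Set.ncard_coe_finset, Finset.card_map, Finset.card_sigma]
    calc _ ≤ ∑ a : A, d := by
          apply Finset.sum_le_sum
          intro a _
          refine le_trans (le_of_eq ?_) (hz (x a))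
          rw [← Set.ncard_coe_finset]; congr 1; ext t; simp
      _ = _ := by simp
  · intro x y hxy
    rw [dist_pi_lt_iff hε]
    intro a
    exact hcls _ _ (fun t => hxy (a, t))

lemma signProp_homeo {X Y : Type} [MetricSpace X] [MetricSpace Y] [CompactSpace Y]
    (e : X ≃ₜ Y) (d : ℕ) (H : SignProp Y d) : SignProp X d := by
  intro ε hε
  have hu : UniformContinuous e.symm :=
    CompactSpace.uniformContinuous_of_continuous e.symm.continuous
  obtain ⟨δ, hδ, hd⟩ := Metric.uniformContinuous_iff.1 hu ε hε
  obtain ⟨T, iT, h, hcont, hz, hcls⟩ := H δ hδ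
  refine ⟨T, iT, fun t x => h t (e x), fun t => (hcont t).comp e.continuous, fun x => hz (e x), ?_⟩
  intro x y hxy
  have := hd (hcls _ _ hxy)
  simpa using this


lemma bad_null {N : ℕ} (s : Set (Fin N → ℝ)) (n : ℕ)
    (hn : Module.finrank ℝ (vectorSpan ℝ s) ≤ n) (T : Type) [Fintype T] (ix : T → Fin N)
    (A : Finset T) (hA : A.card = n + 1) :
    MeasureTheory.volume {t : T → ℝ | ∃ x ∈ affineSpan ℝ s, ∀ a ∈ A, x (ix a) = t a} = 0 := by
  classical
  let φ : (Fin N → ℝ) →ₗ[ℝ] (A → ℝ) := LinearMap.funLeft ℝ ℝ (fun a : A => ix a.1)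
  let r : (T → ℝ) →ₗ[ℝ] (A → ℝ) := LinearMap.funLeft ℝ ℝ (fun a : A => a.1)
  let B : AffineSubspace ℝ (T → ℝ) := ((affineSpan ℝ s).map φ.toAffineMap).comap r.toAffineMap
  have hB : {t : T → ℝ | ∃ x ∈ affineSpan ℝ s, ∀ a ∈ A, x (ix a) = t a} ⊆ (B : Set (T → ℝ)) := by
    rintro t ⟨x, hx, hxt⟩
    simp only [B, SetLike.mem_coe, AffineSubspace.mem_comap, AffineSubspace.mem_map]
    refine ⟨x, hx, ?_⟩
    funext a
    exact hxt a.1 a.2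
  refine MeasureTheory.measure_mono_null hB ?_
  apply MeasureTheory.Measure.addHaar_affineSubspace
  intro htop
  have hsurj : Function.Surjective r :=
    LinearMap.funLeft_surjective_of_injective ℝ ℝ _ Subtype.val_injective
  have h1 : (affineSpan ℝ s).map φ.toAffineMap = ⊤ := by
    rw [eq_top_iff]
    intro y _
    obtain ⟨t, rfl⟩ := hsurj y
    have : t ∈ B := by rw [htop]; trivial
    exact this
  have h2 := congrArg AffineSubspace.direction h1
  rw [AffineSubspace.map_direction, AffineSubspace.direction_top, direction_affineSpan] at h2
  have h3 : Module.finrank ℝ (A → ℝ) ≤ Module.finrank ℝ (vectorSpan ℝ s) := by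
    rw [← finrank_top ℝ (A → ℝ), ← h2]
    exact Submodule.finrank_map_le _ _
  rw [Module.finrank_fintype_fun_eq_card] at h3
  simp [hA] at h3
  omega

lemma signProp_poly {N : ℕ} (S : Finset (Finset (Fin N → ℝ))) (n : ℕ)
    (hn : ∀ s ∈ S, Module.finrank ℝ (vectorSpan ℝ (s : Set (Fin N → ℝ))) ≤ n) :
    SignProp (⋃ s ∈ S, convexHull ℝ (s : Set (Fin N → ℝ)) : Set (Fin N → ℝ)) n := by
  classical
  set K : Set (Fin N → ℝ) := ⋃ s ∈ S, convexHull ℝ (s : Set (Fin N → ℝ)) with hK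
  have hbdd : Bornology.IsBounded K := by
    rw [hK, Bornology.isBounded_biUnion_finset]
    intro s _
    exact (isBounded_convexHull).2 s.finite_toSet.isBounded
  obtain ⟨R, hR⟩ := hbdd.exists_norm_le
  intro ε hε
  set η := ε / 3 with hη
  have hη0 : 0 < η := by positivity
  obtain ⟨M, hM⟩ := exists_nat_gt (R / η + 1)
  let T := Fin N × ↥(Finset.Icc (-(M : ℤ)) M)
  let box : Set (T → ℝ) := Set.pi Set.univ fun a : T =>
    Set.Ioo (((a.2 : ℤ) : ℝ) * η) ((((a.2 : ℤ) : ℝ) + 1) * η)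
  have hbox_open : IsOpen box := isOpen_set_pi Set.finite_univ fun _ _ => isOpen_Ioo
  have hbox_ne : box.Nonempty := by
    refine ⟨fun a => (((a.2 : ℤ) : ℝ) + 1/2) * η, ?_⟩
    intro a _
    constructor <;> nlinarith
  have hpos : MeasureTheory.volume box ≠ 0 := (hbox_open.measure_pos _ hbox_ne).ne'
  let bad : Set (T → ℝ) := ⋃ s ∈ S, ⋃ A ∈ (Finset.univ : Finset (Finset T)).filter (fun A => A.card = n + 1),
    {t : T → ℝ | ∃ x ∈ affineSpan ℝ (s : Set (Fin N → ℝ)), ∀ a ∈ A, x a.1 = t a}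
  have hbad : MeasureTheory.volume bad = 0 := by
    refine (MeasureTheory.measure_biUnion_null_iff S.countable_toSet).2 ?_
    intro s hs
    refine (MeasureTheory.measure_biUnion_null_iff (Finset.countable_toSet _)).2 ?_
    intro A hA
    exact bad_null _ n (hn s hs) T (fun a => a.1) A (by simpa using hA)
  have : ∃ t ∈ box, t ∉ bad := by
    by_contra hcon
    push Not at hcon
    exact hpos (MeasureTheory.measure_mono_null hcon hbad)
  obtain ⟨t, htbox, htbad⟩ := this
  refine ⟨T, inferInstance, fun a x => x.1 a.1 - t a, ?_, ?_, ?_⟩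
  · intro a
    exact ((continuous_apply a.1).comp continuous_subtype_val).sub continuous_const
  · rintro ⟨x, hx⟩
    by_contra hcon
    push Not at hcon
    rw [Set.ncard_eq_toFinset_card'] at hcon
    obtain ⟨A, hA, hAc⟩ := Finset.exists_subset_card_eq (Nat.succ_le_of_lt hcon)
    simp only [hK, Set.mem_iUnion] at hx
    obtain ⟨s, hs, hxs⟩ := hx
    apply htbad
    simp only [bad, Set.mem_iUnion]
    refine ⟨s, hs, A, by simpa using hAc, x, convexHull_subset_affineSpan _ hxs, ?_⟩
    intro a ha
    have := hA ha
    simp at this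
    linarith
  · have key : ∀ x y : K, (∀ a : T, SignType.sign (x.1 a.1 - t a) = SignType.sign (y.1 a.1 - t a)) →
        ∀ i, y.1 i - x.1 i ≤ 2 * η := by
      intro x y hxy i
      by_contra hcon
      push Not at hcon
      have hx := (norm_le_pi_norm x.1 i).trans (hR x.1 x.2)
      have hy := (norm_le_pi_norm y.1 i).trans (hR y.1 y.2)
      rw [Real.norm_eq_abs, abs_le] at hx hy
      have c1 := Int.le_ceil (x.1 i / η)
      have c2 := Int.ceil_lt_add_one (x.1 i / η)
      set j := ⌈x.1 i / η⌉ with hj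
      rw [div_le_iff₀ hη0] at c1
      have c2' : ((j : ℝ) - 1) * η < x.1 i := by
        rw [← lt_div_iff₀ hη0]; linarith
      have hMη : R + η < M * η := by
        have := mul_lt_mul_of_pos_right hM hη0
        have e : (R / η + 1) * η = R + η := by field_simp
        linarith
      have hjM : j ∈ Finset.Icc (-(M : ℤ)) M := by
        rw [Finset.mem_Icc]
        constructor
        · have : (-(M:ℝ)) * η ≤ j * η := by nlinarith
          have := le_of_mul_le_mul_right this hη0
          exact_mod_cast this
        · have : (j : ℝ) * η ≤ M * η := by nlinarith
          have := le_of_mul_le_mul_right this hη0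
          exact_mod_cast this
      have hb := htbox (i, ⟨j, hjM⟩) trivial
      have hsg := hxy (i, ⟨j, hjM⟩)
      simp only [Set.mem_Ioo] at hb hsg
      rw [sign_neg (by linarith), sign_pos (by nlinarith)] at hsg
      exact absurd hsg (by decide)
    intro x y hxy
    rw [Subtype.dist_eq]
    refine lt_of_le_of_lt ((dist_pi_le_iff (by positivity : 0 ≤ 2 * η)).2 fun i => ?_)
      (by rw [hη]; linarith)
    rw [Real.dist_eq, abs_le]
    have h1 := key x y hxy i
    have h2 := key y x (fun a => (hxy a).symm) i
    constructor <;> linarith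

lemma cube_poly {N : ℕ} (s : Finset (Fin N → ℝ)) (hs : s.Nonempty) (n : ℕ)
    (hn : Module.finrank ℝ (vectorSpan ℝ (s : Set (Fin N → ℝ))) = n) :
    ∃ e : (Fin n → unitInterval) → (Fin N → ℝ), Continuous e ∧ Function.Injective e ∧
      ∀ u, e u ∈ convexHull ℝ (s : Set (Fin N → ℝ)) := by
  classical
  obtain ⟨t, hts, hspan, hind⟩ := exists_affineIndependent ℝ (Fin N → ℝ) (s : Set (Fin N → ℝ))
  have : Fintype t := (s.finite_toSet.subset hts).fintype
  have htne : Nonempty t := by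
    by_contra hcon
    rw [not_nonempty_iff, Set.isEmpty_coe_sort] at hcon
    rw [hcon, AffineSubspace.span_empty] at hspan
    have := (affineSpan_eq_bot (k := ℝ) (s := (s : Set (Fin N → ℝ)))).1 hspan.symm
    simp at this
    exact hs.ne_empty this
  have hcard : Fintype.card t = n + 1 := by
    obtain ⟨m, hm⟩ : ∃ m, Fintype.card t = m + 1 := ⟨Fintype.card t - 1, by
      have := Fintype.card_pos (α := t); omega⟩
    have h1 := hind.finrank_vectorSpan hm
    rw [Subtype.range_coe, ← direction_affineSpan, hspan, direction_affineSpan, hn] at h1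
    rw [hm, h1]
  let q := (Fintype.equivFinOfCardEq hcard).symm
  let p : Fin (n+1) → (Fin N → ℝ) := fun i => (q i).1
  have hp : AffineIndependent ℝ p := hind.comp_embedding q.toEmbedding
  rw [affineIndependent_iff] at hp
  let w : (Fin n → unitInterval) → Fin (n+1) → ℝ := fun u =>
    Fin.cons (1 - ∑ i, (u i : ℝ) / (n+1)) (fun i => (u i : ℝ) / (n+1))
  have hw1 : ∀ u, ∑ i, w u i = 1 := by
    intro u; rw [Fin.sum_univ_succ]; simp [w]
  have hw0 : ∀ u i, 0 ≤ w u i := by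
    intro u i
    refine Fin.cases ?_ (fun i => ?_) i
    · simp only [w, Fin.cons_zero]
      have : ∑ i, (u i : ℝ) / (n+1) ≤ ∑ i : Fin n, (1:ℝ) / (n+1) := by
        apply Finset.sum_le_sum
        intro i _
        apply div_le_div_of_nonneg_right (u i).2.2 (by positivity)
      have h2 : ∑ i : Fin n, (1:ℝ) / (n+1) ≤ 1 := by
        simp
        rw [← div_eq_mul_inv, div_le_one (by positivity)]; linarith
      linarith
    · simp only [w, Fin.cons_succ]
      exact div_nonneg (u i).2.1 (by positivity)
  refine ⟨fun u => ∑ i, w u i • p i, ?_, ?_, ?_⟩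
  · apply continuous_finsetSum
    intro i _
    have hc : Continuous fun u => w u i := by
      refine Fin.cases ?_ (fun i => ?_) i
      · simp only [w, Fin.cons_zero]; fun_prop
      · simp only [w, Fin.cons_succ]; fun_prop
    fun_prop
  · intro u u' huu
    simp only at huu
    have := hp Finset.univ (fun i => w u i - w u' i) (by simp [hw1])
      (by simp only [sub_smul, Finset.sum_sub_distrib, huu, sub_self])
    funext i
    have h := this i.succ (Finset.mem_univ _)
    simp only [w, Fin.cons_succ] at h
    apply Subtype.ext
    have hn0 : (n : ℝ) + 1 ≠ 0 := by positivity
    field_simp at h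
    linarith
  · intro u
    apply (convex_convexHull ℝ _).sum_mem (fun i _ => hw0 u i) (hw1 u)
    intro i _
    exact subset_convexHull ℝ _ (hts (q i).2)

lemma polyhedron_main (P : Type) [MetricSpace P] [CompactSpace P] [Nonempty P]
    (hP : IsPolyhedron P) : ∃ n, SignProp P n ∧
      ∃ e : (Fin n → unitInterval) → P, Continuous e ∧ Function.Injective e := by
  classical
  obtain ⟨N, S, ⟨φ⟩⟩ := hP
  have hex : (S.filter fun s => s.Nonempty).Nonempty := by
    obtain ⟨p⟩ := ‹Nonempty P›
    have := (φ p).2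
    simp only [Set.mem_iUnion] at this
    obtain ⟨s, hs, hx⟩ := this
    have hne : (convexHull ℝ (s : Set (Fin N → ℝ))).Nonempty := ⟨_, hx⟩
    rw [convexHull_nonempty_iff] at hne
    exact ⟨s, Finset.mem_filter.2 ⟨hs, by simpa using hne⟩⟩
  obtain ⟨s, hs, hmax⟩ := Finset.exists_max_image _
    (fun s : Finset (Fin N → ℝ) => Module.finrank ℝ (vectorSpan ℝ (s : Set (Fin N → ℝ)))) hex
  obtain ⟨hsS, hsne⟩ := Finset.mem_filter.1 hs
  refine ⟨Module.finrank ℝ (vectorSpan ℝ (s : Set (Fin N → ℝ))), ?_, ?_⟩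
  · have : CompactSpace (⋃ s ∈ S, convexHull ℝ (s : Set (Fin N → ℝ)) : Set (Fin N → ℝ)) :=
      φ.compactSpace
    apply signProp_homeo φ
    apply signProp_poly
    intro s' hs'
    by_cases hne : s'.Nonempty
    · exact hmax s' (Finset.mem_filter.2 ⟨hs', hne⟩)
    · rw [Finset.not_nonempty_iff_eq_empty] at hne
      rw [hne, Finset.coe_empty, vectorSpan_empty, finrank_bot]
      exact Nat.zero_le _
  · obtain ⟨e, he, hinj, hmem⟩ := cube_poly s hsne _ rfl
    refine ⟨fun u => φ.symm ⟨e u, Set.mem_biUnion hsS (hmem u)⟩, ?_, ?_⟩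
    · exact φ.symm.continuous.comp (he.subtype_mk _)
    · intro u v huv
      have := φ.symm.injective huv
      exact hinj (Subtype.ext_iff.1 this)

lemma topDim_poly (P : Type) [MetricSpace P] [CompactSpace P] (n : ℕ) (h : SignProp P n)
    (e : (Fin n → unitInterval) → P) (he : Continuous e) (hinj : Function.Injective e) :
    topDim P = n := by
  apply le_antisymm (topDim_le_of_signProp P n h)
  have := dim_lower (Fin n) P e he (by
    rintro x y hxy i ⟨h0, h1⟩
    rw [hinj hxy, h1] at h0
    exact one_ne_zero h0)
  simpa using this


lemma compat_uc {Y Z : Type} [TopologicalSpace Y] [CompactSpace Y] [MetricSpace Z]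
    {ρ : Y → Y → ℝ} (hρ : IsCompatMetric ρ) (f : Y → Z) (hf : Continuous f) (δ : ℝ) (hδ : 0 < δ) :
    ∃ ε > 0, ∀ x y, ρ x y ≤ ε → dist (f x) (f y) < δ := by
  obtain ⟨h0, hsymm, htri, hnhds⟩ := hρ
  have h1 : ∀ x, ∃ r > 0, ∀ y, ρ x y < r → dist (f x) (f y) < δ / 2 := by
    intro x
    have : {y | dist (f x) (f y) < δ / 2} ∈ 𝓝 x := by
      have := hf.continuousAt.preimage_mem_nhds (Metric.ball_mem_nhds (f x) (half_pos hδ))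
      filter_upwards [this] with y hy
      rw [Set.mem_preimage, Metric.mem_ball, dist_comm] at hy
      exact hy
    obtain ⟨r, hr, hsub⟩ := (hnhds x _).1 this
    exact ⟨r, hr, fun y hy => hsub hy⟩
  choose r hr hrd using h1
  obtain ⟨t, -, ht⟩ := (isCompact_univ (X := Y)).elim_nhds_subcover (fun x => {y | ρ x y < r x / 2})
    (fun x _ => (hnhds x _).2 ⟨r x / 2, half_pos (hr x), subset_rfl⟩)
  have hmin : ∃ ε > 0, ∀ x ∈ t, ε < r x / 2 := by
    clear ht
    classical
    induction t using Finset.induction_on with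
    | empty => exact ⟨1, one_pos, by simp⟩
    | insert a s ha ih =>
      obtain ⟨ε, hε, h⟩ := ih
      refine ⟨min ε (r a / 4), lt_min hε (by have := hr a; linarith), ?_⟩
      intro x hx
      rcases Finset.mem_insert.1 hx with rfl | hx
      · exact lt_of_le_of_lt (min_le_right _ _) (by have := hr x; linarith)
      · exact lt_of_le_of_lt (min_le_left _ _) (h x hx)
  obtain ⟨ε, hε, hεr⟩ := hmin
  refine ⟨ε, hε, fun x y hxy => ?_⟩
  have := ht (Set.mem_univ x)
  simp only [Set.mem_iUnion] at this
  obtain ⟨a, hat, hax⟩ := this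
  have hax' : ρ a x < r a / 2 := hax
  have e1 := hrd a x (by have := hr a; linarith)
  have e2 := hrd a y (by have := htri a x y; have := hεr a hat; linarith)
  have := dist_triangle_left (f x) (f y) (f a)
  linarith

lemma compat_coord {G P : Type} [MetricSpace P] [CompactSpace P]
    {ρ : (G → P) → (G → P) → ℝ} (hρ : IsCompatMetric ρ) (ε : ℝ) (hε : 0 < ε) :
    ∃ K : Finset G, ∀ x y, (∀ k ∈ K, x k = y k) → ρ x y ≤ ε := by
  obtain ⟨h0, hsymm, htri, hnhds⟩ := hρ
  obtain ⟨V, hV, hVs⟩ := lebesgue_number_lemma (isCompact_univ (X := G → P))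
    (U := fun x => interior {y | ρ x y < ε / 2}) (fun x => isOpen_interior) (by
      intro x _
      refine Set.mem_iUnion.2 ⟨x, ?_⟩
      rw [mem_interior_iff_mem_nhds, hnhds]
      exact ⟨ε / 2, half_pos hε, subset_rfl⟩)
  rw [Pi.uniformity, Filter.mem_iInf_finite] at hV
  obtain ⟨K, hK⟩ := hV
  refine ⟨K, fun x y hxy => ?_⟩
  have hmem : (x, y) ∈ V := by
    have hle : (pure (x, y) : Filter ((G → P) × (G → P))) ≤
        ⨅ i ∈ K, comap (fun a : (G → P) × (G → P) => (a.1 i, a.2 i)) (uniformity P) := by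
      refine le_iInf₂ fun k hk => ?_
      rw [← Filter.map_le_iff_le_comap, Filter.map_pure]
      simp only [hxy k hk]
      intro s hs
      exact refl_mem_uniformity hs
    exact hle hK
  obtain ⟨i, hi⟩ := hVs x trivial
  have hVrefl : (x, x) ∈ V := by
    have hle : (pure (x, x) : Filter ((G → P) × (G → P))) ≤
        ⨅ i ∈ K, comap (fun a : (G → P) × (G → P) => (a.1 i, a.2 i)) (uniformity P) := by
      refine le_iInf₂ fun k hk => ?_
      rw [← Filter.map_le_iff_le_comap, Filter.map_pure]
      intro s hs
      exact refl_mem_uniformity hs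
    exact hle hK
  have a1' : x ∈ {y | ρ i y < ε / 2} := interior_subset (hi hVrefl)
  have a2' : y ∈ {y | ρ i y < ε / 2} := interior_subset (hi hmem)
  have a1 : ρ i x < ε / 2 := a1'
  have a2 : ρ i y < ε / 2 := a2'
  have := htri x i y
  rw [hsymm x i] at this
  linarith

lemma boundary_finite {G : Type} [Group G] (F K : Finset G) :
    {g : G | (∃ k ∈ K, k * g ∈ F) ∧ ∃ k ∈ K, k * g ∉ F}.Finite := by
  classical
  apply Set.Finite.subset ((K.finite_toSet).biUnion (fun k _ => (F.image fun f => k⁻¹ * f).finite_toSet))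
  rintro g ⟨⟨k, hk, hkg⟩, -⟩
  simp only [Set.mem_iUnion]
  refine ⟨k, hk, ?_⟩
  simp only [Finset.coe_image, Set.mem_image]
  exact ⟨k * g, hkg, by simp⟩

lemma folner_translate {G : Type} [Group G] (hAmen : ∃ F : ℕ → Finset G, IsFolner F) (J : Set G)
    (η : ℝ) (hη : 0 < η) (hJ : 1 - η < upperDensity J) (F : Finset G) :
    ∃ g, (1 - 2 * η) * F.card ≤ Set.ncard {f | f ∈ F ∧ f * g ∈ J} := by
  classical
  obtain ⟨F₀, hF₀⟩ := hAmen
  have hne : Set.Nonempty {r : ℝ | ∃ F : ℕ → Finset G, IsFolner F ∧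
      Filter.atTop.limsup (fun n => ((J ∩ (F n : Set G)).ncard : ℝ) / (F n).card) = r} :=
    ⟨_, F₀, hF₀, rfl⟩
  obtain ⟨_, ⟨F', hF', rfl⟩, hlt⟩ := exists_lt_of_lt_csSup hne hJ
  have hfreq := frequently_lt_of_lt_limsup (by
    apply Filter.IsBoundedUnder.isCoboundedUnder_le
    exact isBoundedUnder_of ⟨0, fun n => by positivity⟩) hlt
  let K : Finset G := insert 1 (F.image fun f => f⁻¹)
  have hev := (hF'.2 K).eventually (gt_mem_nhds hη)
  obtain ⟨n, h1, h2⟩ := (hfreq.and_eventually hev).exists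
  set E := F' n with hE
  have hEpos : (0 : ℝ) < E.card := by exact_mod_cast (hF'.1 n).card_pos
  rw [lt_div_iff₀ hEpos] at h1
  rw [div_lt_iff₀ hEpos] at h2
  set b := Set.ncard {g : G | (∃ k ∈ K, k * g ∈ E) ∧ ∃ k ∈ K, k * g ∉ E} with hb
  have hj : (J ∩ (E : Set G)).ncard = (E.filter (fun g => g ∈ J)).card := by
    rw [← Set.ncard_coe_finset]; congr 1; ext g; simp [and_comm]
  -- for each f, the count
  have hf : ∀ f ∈ F, (J ∩ (E : Set G)).ncard ≤ (E.filter (fun g => f * g ∈ J)).card + b := by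
    intro f hf
    have hsub : J ∩ (E : Set G) ⊆ ((E.filter (fun g => f * g ∈ J)).image (fun g => f * g) : Finset G) ∪
        {g : G | (∃ k ∈ K, k * g ∈ E) ∧ ∃ k ∈ K, k * g ∉ E} := by
      rintro h ⟨hJ', hE'⟩
      by_cases hc : f⁻¹ * h ∈ E
      · left
        simp only [Finset.coe_image, Set.mem_image]
        exact ⟨f⁻¹ * h, by simpa using ⟨hc, hJ'⟩, by simp⟩
      · right
        refine ⟨⟨1, by simp [K], by simpa using hE'⟩, f⁻¹, ?_, hc⟩
        simp [K, hf]
    calc _ ≤ _ := Set.ncard_le_ncard hsub ((Finset.finite_toSet _).union (boundary_finite E K))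
      _ ≤ _ := Set.ncard_union_le _ _
      _ ≤ _ := by
        rw [Set.ncard_coe_finset]
        exact Nat.add_le_add_right Finset.card_image_le _
  have hdouble : ∑ g ∈ E, (F.filter (fun f => f * g ∈ J)).card =
      ∑ f ∈ F, (E.filter (fun g => f * g ∈ J)).card := by
    simp only [Finset.card_filter]
    exact Finset.sum_comm
  by_contra hcon
  push Not at hcon
  have hup : ∑ g ∈ E, ((F.filter (fun f => f * g ∈ J)).card : ℝ) < ∑ g ∈ E, (1 - 2 * η) * F.card := by
    apply Finset.sum_lt_sum_of_nonempty (hF'.1 n)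
    intro g _
    refine lt_of_eq_of_lt ?_ (hcon g)
    rw [← Set.ncard_coe_finset]
    congr 2
    ext f; simp
  have hlow : ∑ f ∈ F, ((1 - 2 * η) * E.card) ≤
      ∑ f ∈ F, ((E.filter (fun g => f * g ∈ J)).card : ℝ) := by
    apply Finset.sum_le_sum
    intro f hfF
    have := hf f hfF
    have h3 : ((J ∩ (E : Set G)).ncard : ℝ) ≤ (E.filter (fun g => f * g ∈ J)).card + b := by
      exact_mod_cast this
    nlinarith
  have hd : ∑ g ∈ E, ((F.filter (fun f => f * g ∈ J)).card : ℝ) =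
      ∑ f ∈ F, ((E.filter (fun g => f * g ∈ J)).card : ℝ) := by exact_mod_cast hdouble
  simp only [Finset.sum_const, nsmul_eq_mul] at hup hlow
  rw [hd] at hup
  nlinarith

lemma cube_sep {n : ℕ} {P : Type} [MetricSpace P] (e : (Fin n → unitInterval) → P)
    (he : Continuous e) (hinj : Function.Injective e) :
    ∃ δ > 0, ∀ u v, 1 ≤ dist u v → δ ≤ dist (e u) (e v) := by
  have hc : IsCompact {q : (Fin n → unitInterval) × (Fin n → unitInterval) | 1 ≤ dist q.1 q.2} :=
    (isClosed_le continuous_const (continuous_fst.dist continuous_snd)).isCompact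
  obtain ⟨δ, hδ, h⟩ := hc.exists_forall_le' (f := fun q => dist (e q.1) (e q.2)) (a := 0)
    (by fun_prop) (by
      rintro ⟨u, v⟩ huv
      refine dist_pos.2 fun hh => ?_
      have : u = v := hinj hh
      subst this
      have h1 : (1 : ℝ) ≤ dist u u := huv
      rw [dist_self] at h1
      linarith)
  exact ⟨δ, hδ, fun u v huv => h (u, v) huv⟩

lemma lower_main {G : Type} [Group G] {P : Type} [MetricSpace P] [CompactSpace P]
    (n : ℕ) (e : (Fin n → unitInterval) → P) (he : Continuous e) (hinj : Function.Injective e)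
    (X : Set (G → P)) (hXinv : ∀ (g : G), ∀ x ∈ X, shift g x ∈ X)
    (J : Set G) (W : G → Set P) (hWsub : {x : G → P | ∀ g, x g ∈ W g} ⊆ X)
    (w : G → P) (hw : ∀ g, w g ∈ W g) (c : ℝ) (hc : 0 < c)
    (hf : ∀ g ∈ J, ∃ f : P → P, Continuous f ∧ (∀ p, f p ∈ W g) ∧
      ∀ p q : P, dist p q ≤ c * dist (f p) (f q))
    (ρ : (G → P) → (G → P) → ℝ) (hρ : IsCompatMetric ρ) :
    ∃ ε > 0, ∀ (F : Finset G) (hF : F.Nonempty) (g : G),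
      ((Set.ncard {f | f ∈ F ∧ f * g ∈ J} * n : ℕ) : ENNReal) ≤
      dimEps X (fun x y => F.sup' hF fun g => ρ (shift g x.1) (shift g y.1)) ε := by
  classical
  obtain ⟨δ, hδ, hsep⟩ := cube_sep e he hinj
  obtain ⟨ε, hε, huc⟩ := compat_uc hρ (fun x : G → P => x 1) (continuous_apply 1) (δ / c)
    (by positivity)
  refine ⟨ε, hε, fun F hF g => ?_⟩
  apply le_sInf
  rintro d ⟨Q, _, φ, hQ, hφ, hφi, rfl⟩
  have hf' : ∀ h, ∃ f : P → P, h ∈ J → Continuous f ∧ (∀ p, f p ∈ W h) ∧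
      ∀ p q : P, dist p q ≤ c * dist (f p) (f q) := by
    intro h
    by_cases hJ : h ∈ J
    · obtain ⟨f, hf⟩ := hf h hJ
      exact ⟨f, fun _ => hf⟩
    · exact ⟨id, fun hh => absurd hh hJ⟩
  choose f hfc using hf'
  let A : Finset G := F.filter fun a => a * g ∈ J
  have hA : Set.ncard {f | f ∈ F ∧ f * g ∈ J} = A.card := by
    rw [← Set.ncard_coe_finset]; congr 1; ext a; simp [A]
  let z : (A × Fin n → unitInterval) → G → P := fun u h =>
    if hh : h * g⁻¹ ∈ A then f h (e fun i => u (⟨h * g⁻¹, hh⟩, i)) else w h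
  have hJmem : ∀ h, h * g⁻¹ ∈ A → h ∈ J := by
    intro h hh
    have := (Finset.mem_filter.1 hh).2
    simpa using this
  have hzX : ∀ u, shift g (z u) ∈ X := by
    intro u
    apply hXinv
    apply hWsub
    intro h
    simp only [z]
    split_ifs with hh
    · exact (hfc h (hJmem h hh)).2.1 _
    · exact hw h
  have hzc : Continuous z := by
    refine continuous_pi fun h => ?_
    simp only [z]
    split_ifs with hh
    · refine (hfc h (hJmem h hh)).1.comp (he.comp ?_)
      fun_prop
    · exact continuous_const
  have hψ : Continuous fun u => (⟨shift g (z u), hzX u⟩ : X) := by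
    refine Continuous.subtype_mk ?_ _
    refine continuous_pi fun h => ?_
    exact (continuous_apply (h * g)).comp hzc
  have := dim_lower (A × Fin n) Q (fun u => φ ⟨shift g (z u), hzX u⟩) (hφ.comp hψ) (by
    rintro u v huv ⟨a, i⟩ ⟨hu0, hv1⟩
    have hd := hφi _ _ huv
    rw [Finset.sup'_le_iff] at hd
    have haF := (Finset.mem_filter.1 a.2).1
    have haJ := (Finset.mem_filter.1 a.2).2
    have h1 := huc _ _ (hd a.1 haF)
    simp only [shift, one_mul] at h1
    have hz : ∀ u, z u (a.1 * g) = f (a.1 * g) (e fun i => u (a, i)) := by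
      intro u
      have hm : a.1 * g * g⁻¹ = a.1 := by simp
      simp only [z]
      rw [dif_pos (by rw [hm]; exact a.2)]
      congr 2
      funext i
      congr 2
      exact Subtype.ext hm
    rw [hz, hz] at h1
    have h2 := (hfc _ haJ).2.2 (e fun i => u (a, i)) (e fun i => v (a, i))
    have h3 : dist (e fun i => u (a, i)) (e fun i => v (a, i)) < δ := by
      rw [lt_div_iff₀ hc] at h1
      linarith
    have h4 : ¬ (1 ≤ dist (fun i => u (a, i)) (fun i => v (a, i))) :=
      fun hh => absurd (hsep _ _ hh) (not_le.2 h3)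
    apply h4
    refine le_trans (le_of_eq ?_) (dist_le_pi_dist _ _ i)
    rw [hu0, hv1, Subtype.dist_eq]
    simp)
  rw [Fintype.card_prod, Fintype.card_coe, Fintype.card_fin] at this
  rw [hA]
  exact this

lemma upper_main {G : Type} [Group G] {P : Type} [MetricSpace P] [CompactSpace P]
    (n : ℕ) (hP : SignProp P n)
    (X : Set (G → P)) (ρ : (G → P) → (G → P) → ℝ) (hρ : IsCompatMetric ρ) (ε : ℝ) (hε : 0 < ε) :
    ∃ K : Finset G, ∀ (F : Finset G) (hF : F.Nonempty),
      dimEps X (fun x y => F.sup' hF fun g => ρ (shift g x.1) (shift g y.1)) ε ≤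
        (((F.card + Set.ncard {g : G | (∃ k ∈ K, k * g ∈ F) ∧ ∃ k ∈ K, k * g ∉ F}) * n : ℕ) :
          ENNReal) := by
  classical
  obtain ⟨K, hK⟩ := compat_coord hρ ε hε
  refine ⟨insert 1 (K.image fun k => k⁻¹), fun F hF => ?_⟩
  set K' := insert 1 (K.image fun k => k⁻¹) with hK'
  let A : Finset G := (K ×ˢ F).image fun p => p.1 * p.2
  have hA : A.card ≤ F.card + Set.ncard {g : G | (∃ k ∈ K', k * g ∈ F) ∧ ∃ k ∈ K', k * g ∉ F} := by
    have hsub : (A : Set G) ⊆ (F : Set G) ∪ {g : G | (∃ k ∈ K', k * g ∈ F) ∧ ∃ k ∈ K', k * g ∉ F} := by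
      intro h hh
      simp only [A, Finset.coe_image, Set.mem_image] at hh
      obtain ⟨⟨k, g⟩, hkg, rfl⟩ := hh
      have hkg' := Finset.mem_product.1 (Finset.mem_coe.1 hkg)
      by_cases hc : k * g ∈ F
      · left; exact hc
      · right
        refine ⟨⟨k⁻¹, ?_, ?_⟩, 1, ?_, ?_⟩
        · rw [hK']; exact Finset.mem_insert_of_mem (Finset.mem_image_of_mem _ hkg'.1)
        · simpa using hkg'.2
        · simp [hK']
        · simpa using hc
    rw [← Set.ncard_coe_finset A, ← Set.ncard_coe_finset F]
    exact (Set.ncard_le_ncard hsub (F.finite_toSet.union (boundary_finite F K'))).trans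
      (Set.ncard_union_le _ _)
  have hdim : topDim (A → P) ≤ ((A.card * n : ℕ) : ENNReal) := by
    have := topDim_le_of_signProp (A → P) _ (signProp_pi P n hP A)
    rwa [Fintype.card_coe] at this
  refine le_trans (sInf_le ⟨A → P, inferInstance, fun x a => x.1 a.1, inferInstance, ?_, ?_, rfl⟩)
    (hdim.trans ?_)
  · exact continuous_pi fun a => (continuous_apply a.1).comp continuous_subtype_val
  · intro x y hxy
    rw [Finset.sup'_le_iff]
    intro g hg
    apply hK
    intro k hk
    have := congrFun hxy ⟨k * g, Finset.mem_image.2 ⟨(k, g), Finset.mem_product.2 ⟨hk, hg⟩, rfl⟩⟩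
    exact this
  · exact_mod_cast Nat.mul_le_mul_right n hA


/-- if `X ⊆ P^G` is a subshift satisfying the lower-bound criterion along
an increasing sequence `J_m ⊆ G` whose upper densities tend to `1`, then
`mdim(X,G) = dim(P)` (for every compatible metric on `P^G` and Følner sequence). -/
theorem stmt17 {G : Type} [Group G] [Countable G] [Infinite G]
    (hAmen : ∃ F : ℕ → Finset G, IsFolner F)
    (P : Type) [MetricSpace P] [CompactSpace P] [Nonempty P] (hP : IsPolyhedron P)
    (X : Set (G → P)) (hXcl : IsClosed X)
    (hXinv : ∀ (g : G), ∀ x ∈ X, shift g x ∈ X)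
    (J : ℕ → Set G) (hJmono : ∀ m, J m ⊆ J (m + 1))
    (hJdens : Filter.Tendsto (fun m => upperDensity (J m)) Filter.atTop (nhds 1))
    (x₀ : G → P) (hx₀ : x₀ ∈ X)
    (W : ℕ → G → Set P)
    (hWsub : ∀ m, {x : G → P | ∀ g, x g ∈ W m g} ⊆ X)
    (hWx₀ : ∀ m, ∃ w : G → P, (∀ g, w g ∈ W m g) ∧ ∀ g ∉ J m, w g = x₀ g)
    (c : ℕ → ℝ) (hc : ∀ m, 0 < c m)
    (hf : ∀ m, ∀ g ∈ J m, ∃ f : P → P, Continuous f ∧ (∀ p, f p ∈ W m g) ∧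
      ∀ p q : P, dist p q ≤ c m * dist (f p) (f q)) :
    ∀ (ρ : (G → P) → (G → P) → ℝ), IsCompatMetric ρ →
      ∀ (F : ℕ → Finset G) (hF : IsFolner F),
        mdimWith X ρ F hF.1 = topDim P := by
  intro ρ hρ F hF
  obtain ⟨n, hsign, e, he, hinj⟩ := polyhedron_main P hP
  rw [topDim_poly P n hsign e he hinj]
  apply le_antisymm
  · refine iSup₂_le fun ε hε => ?_
    obtain ⟨K, hK⟩ := upper_main n hsign X ρ hρ ε hε
    have hlim : Tendsto (fun i => ENNReal.ofReal ((1 +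
        (Set.ncard {g : G | (∃ k ∈ K, k * g ∈ F i) ∧ ∃ k ∈ K, k * g ∉ F i} : ℝ)
          / (F i).card) * n)) atTop (nhds (n : ENNReal)) := by
      have h1 := ((hF.2 K).const_add 1).mul_const (n : ℝ)
      have h2 := ENNReal.tendsto_ofReal h1
      simpa using h2
    rw [← hlim.limsup_eq]
    refine limsup_le_limsup (Eventually.of_forall fun i => ?_)
    have hpos : (0 : ℝ) < (F i).card := by exact_mod_cast (hF.1 i).card_pos
    have hc0 : ((F i).card : ENNReal) ≠ 0 := by
      exact_mod_cast (hF.1 i).card_pos.ne'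
    refine ENNReal.div_le_of_le_mul ((hK (F i) (hF.1 i)).trans (le_of_eq ?_))
    rw [← ENNReal.ofReal_natCast, ← ENNReal.ofReal_natCast (F i).card,
      ← ENNReal.ofReal_mul (by positivity)]
    congr 1
    push_cast
    field_simp
  · have key : ∀ η : ℝ, 0 < η → ENNReal.ofReal ((1 - 2 * η) * n) ≤ mdimWith X ρ F hF.1 := by
      intro η hη
      obtain ⟨m, hm⟩ := (hJdens.eventually (lt_mem_nhds (show 1 - η < 1 by linarith))).exists
      obtain ⟨w, hw, -⟩ := hWx₀ m
      obtain ⟨ε, hε, hlow⟩ := lower_main n e he hinj X hXinv (J m) (W m) (hWsub m) w hw (c m)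
        (hc m) (hf m) ρ hρ
      refine le_iSup₂_of_le ε hε ?_
      refine le_trans (le_of_eq ?_) (limsup_le_limsup (f := atTop)
        (u := fun _ : ℕ => ENNReal.ofReal ((1 - 2 * η) * n)) (Eventually.of_forall fun i => ?_))
      · exact limsup_const _ |>.symm
      · obtain ⟨g, hg⟩ := folner_translate hAmen (J m) η hη hm (F i)
        have hc0 : ((F i).card : ENNReal) ≠ 0 := by
          exact_mod_cast (hF.1 i).card_pos.ne'
        rw [ENNReal.le_div_iff_mul_le (Or.inl hc0) (Or.inl (ENNReal.natCast_ne_top _))]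
        refine le_trans ?_ (hlow (F i) (hF.1 i) g)
        rw [← ENNReal.ofReal_natCast, ← ENNReal.ofReal_natCast,
          ← ENNReal.ofReal_mul' (by positivity)]
        apply ENNReal.ofReal_le_ofReal
        push_cast
        have hn : (0 : ℝ) ≤ n := by positivity
        nlinarith [mul_le_mul_of_nonneg_right hg hn]
    have hlim : Tendsto (fun η : ℝ => ENNReal.ofReal ((1 - 2 * η) * n)) (nhdsWithin 0 (Set.Ioi 0))
        (nhds (n : ENNReal)) := by
      have h1 : Continuous fun η : ℝ => ENNReal.ofReal ((1 - 2 * η) * n) :=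
        ENNReal.continuous_ofReal.comp (by fun_prop)
      have h2 := h1.tendsto 0
      simp only [mul_zero, sub_zero, one_mul, ENNReal.ofReal_natCast] at h2
      exact h2.mono_left nhdsWithin_le_nhds
    exact le_of_tendsto hlim (by
      filter_upwards [self_mem_nhdsWithin] with η hη using key η hη)
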